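/- Fix 1/3 < α < 1/2 and let Φ_α(ξ) = |ξ|^α. There exists C = C(α) > 0 such that for all Schwartz φ : ℝ → ℂ and all t ∈ ℝ, ‖e^{itΦ_α(D)}φ‖_{L^∞_x(ℝ)} ≤ C(1+|t|)^{−1/2}(‖φ‖_{H¹_x} + ‖x ∂_x φ‖_{L²_x}). -/

import Mathlib

open MeasureTheory FourierTransform Real Complex
open Set (Icc Ioi)

/-- Cauchy–Schwarz on a compact interval. -/
theorem integral_mul_le_of_integral_sq_le {p q G H : ℝ} (hpq : p ≤ q) {g h : ℝ → ℝ}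
    (hg : ContinuousOn g (Icc p q)) (hh : ContinuousOn h (Icc p q)) (hG : 0 < G) (hH : 0 < H)
    (hgG : ∫ x in p..q, g x ^ 2 ≤ G ^ 2) (hhH : ∫ x in p..q, h x ^ 2 ≤ H ^ 2) :
    ∫ x in p..q, g x * h x ≤ G * H := by
  have hg2 : IntervalIntegrable (fun x => H / (2 * G) * g x ^ 2) volume p q :=
    ContinuousOn.intervalIntegrable_of_Icc hpq (by fun_prop)
  have hh2 : IntervalIntegrable (fun x => G / (2 * H) * h x ^ 2) volume p q :=
    ContinuousOn.intervalIntegrable_of_Icc hpq (by fun_prop)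
  calc ∫ x in p..q, g x * h x
      ≤ ∫ x in p..q, (H / (2 * G) * g x ^ 2 + G / (2 * H) * h x ^ 2) := by
        refine intervalIntegral.integral_mono_on hpq
          (ContinuousOn.intervalIntegrable_of_Icc hpq (by fun_prop)) (hg2.add hh2) fun x _ => ?_
        have : H / (2 * G) * g x ^ 2 + G / (2 * H) * h x ^ 2 - g x * h x
            = (H * g x - G * h x) ^ 2 / (2 * G * H) := by
          field_simp
          ring
        have h0 : 0 ≤ (H * g x - G * h x) ^ 2 / (2 * G * H) := by positivity
        linarith
    _ = H / (2 * G) * (∫ x in p..q, g x ^ 2) + G / (2 * H) * ∫ x in p..q, h x ^ 2 := by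
        rw [intervalIntegral.integral_add hg2 hh2, intervalIntegral.integral_const_mul,
          intervalIntegral.integral_const_mul]
    _ ≤ H / (2 * G) * G ^ 2 + G / (2 * H) * H ^ 2 := by gcongr
    _ = G * H := by
        field_simp
        ring

theorem integral_inv_sub_sq_le {r q c v : ℝ} (hrq : r ≤ q) (hv : 0 < v)
    (hc : ∀ x ∈ Icc r q, v ≤ |x - c|) : ∫ x in r..q, (|x - c|⁻¹) ^ 2 ≤ 2 / v := by
  have hne : ∀ x ∈ Icc r q, x - c ≠ 0 := fun x hx => abs_pos.mp (hv.trans_le (hc x hx))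
  have key : ∫ x in r..q, (|x - c|⁻¹) ^ 2 = (-(q - c)⁻¹) - (-(r - c)⁻¹) := by
    refine intervalIntegral.integral_eq_sub_of_hasDerivAt (f := fun x => -(x - c)⁻¹) ?_ ?_
    · intro x hx
      rw [Set.uIcc_of_le hrq] at hx
      have := (((hasDerivAt_id x).sub_const c).fun_inv (hne x hx)).fun_neg
      convert! this using 1
      simp [sq_abs, neg_div]
    · refine ContinuousOn.intervalIntegrable_of_Icc hrq ?_
      have : ∀ x ∈ Icc r q, |x - c| ≠ 0 := fun x hx => abs_ne_zero.mpr (hne x hx)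
      fun_prop (disch := assumption)
  have bound : ∀ x ∈ Icc r q, |(x - c)⁻¹| ≤ 1 / v := fun x hx => by
    rw [abs_inv, ← one_div]
    exact one_div_le_one_div_of_le hv (hc x hx)
  have h1 := (neg_abs_le _).trans' (neg_le_neg (bound q (Set.right_mem_Icc.mpr hrq)))
  have h2 := (le_abs_self _).trans (bound r (Set.left_mem_Icc.mpr hrq))
  have : (2 : ℝ) / v = 1 / v + 1 / v := by ring
  rw [key]
  linarith

/-- Integration by parts away from the stationary point `c` of the phase. -/
theorem norm_integral_nonstationary_le {r q c lam w M b : ℝ} (hrq : r ≤ q) (hlam : 0 < lam)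
    (hw : 0 < w) (hb : 0 < b) {ψ dψ ddψ : ℝ → ℝ} {F F' : ℝ → ℂ}
    (hψ : ∀ x ∈ Icc r q, HasDerivAt ψ (dψ x) x) (hdψ : ∀ x ∈ Icc r q, HasDerivAt dψ (ddψ x) x)
    (hddψ : ContinuousOn ddψ (Icc r q)) (hpos : ∀ x ∈ Icc r q, 0 ≤ ddψ x)
    (hF : ∀ x ∈ Icc r q, HasDerivAt F (F' x) x) (hF' : ContinuousOn F' (Icc r q))
    (hlow : ∀ x ∈ Icc r q, lam * |x - c| ≤ |dψ x|) (hc : ∀ x ∈ Icc r q, w ^ 2 ≤ |x - c|)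
    (hM : ∀ x ∈ Icc r q, ‖F x‖ ≤ M) (hFb : ∫ x in r..q, ‖F' x‖ ^ 2 ≤ b ^ 2) :
    ‖∫ x in r..q, Complex.exp (Complex.I * ψ x) * F x‖ ≤
      4 * M / (lam * w ^ 2) + 2 * b / (lam * w) := by
  have hw2 : 0 < w ^ 2 := by positivity
  have hlow' : ∀ x ∈ Icc r q, lam * w ^ 2 ≤ |dψ x| := fun x hx =>
    (mul_le_mul_of_nonneg_left (hc x hx) hlam.le).trans (hlow x hx)
  have hne : ∀ x ∈ Icc r q, dψ x ≠ 0 := fun x hx =>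
    abs_pos.mp ((by positivity : 0 < lam * w ^ 2).trans_le (hlow' x hx))
  have hneC : ∀ x ∈ Icc r q, Complex.I * (dψ x : ℂ) ≠ 0 := fun x hx =>
    mul_ne_zero Complex.I_ne_zero (by exact_mod_cast hne x hx)
  have hM0 : 0 ≤ M := (norm_nonneg _).trans (hM r (Set.left_mem_Icc.mpr hrq))
  have cψ : ContinuousOn ψ (Icc r q) := fun x hx => (hψ x hx).continuousAt.continuousWithinAt
  have cdψ : ContinuousOn dψ (Icc r q) := fun x hx => (hdψ x hx).continuousAt.continuousWithinAt
  have cF : ContinuousOn F (Icc r q) := fun x hx => (hF x hx).continuousAt.continuousWithinAt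
  have cabs : ∀ x ∈ Icc r q, |x - c| ≠ 0 := fun x hx => (hw2.trans_le (hc x hx)).ne'
  have hsq : ∀ x ∈ Icc r q, dψ x ^ 2 ≠ 0 := fun x hx => pow_ne_zero 2 (hne x hx)
  have hsqC : ∀ x ∈ Icc r q, (Complex.I * (dψ x : ℂ)) ^ 2 ≠ 0 := fun x hx =>
    pow_ne_zero 2 (hneC x hx)
  set u : ℝ → ℂ := fun x => F x / (Complex.I * dψ x) with hu
  set u' : ℝ → ℂ := fun x =>
    (F' x * (Complex.I * dψ x) - F x * (Complex.I * ddψ x)) / (Complex.I * dψ x) ^ 2 with hu'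
  set e : ℝ → ℂ := fun x => Complex.exp (Complex.I * ψ x) with he
  set e' : ℝ → ℂ := fun x => Complex.exp (Complex.I * ψ x) * (Complex.I * dψ x) with he'
  have ce : ContinuousOn e (Icc r q) := by simp only [he]; fun_prop
  have ce' : ContinuousOn e' (Icc r q) := by simp only [he']; fun_prop
  have cu' : ContinuousOn u' (Icc r q) := by
    simp only [hu']
    fun_prop (disch := assumption)
  have ne : ∀ x, ‖e x‖ = 1 := fun x => by
    simp only [he]
    rw [mul_comm]
    exact Complex.norm_exp_ofReal_mul_I _
  have ibp := intervalIntegral.integral_mul_deriv_eq_deriv_mul (u := u) (v := e) (u' := u')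
    (v' := e') (a := r) (b := q)
    (fun x hx => by
      rw [Set.uIcc_of_le hrq] at hx
      exact (hF x hx).div ((hdψ x hx).ofReal_comp.const_mul Complex.I) (hneC x hx))
    (fun x hx => by
      rw [Set.uIcc_of_le hrq] at hx
      exact ((hψ x hx).ofReal_comp.const_mul Complex.I).cexp)
    (cu'.intervalIntegrable_of_Icc hrq) (ce'.intervalIntegrable_of_Icc hrq)
  have lhs : ∫ x in r..q, Complex.exp (Complex.I * ψ x) * F x = ∫ x in r..q, u x * e' x := by
    refine intervalIntegral.integral_congr fun x hx => ?_
    rw [Set.uIcc_of_le hrq] at hx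
    have : (dψ x : ℂ) ≠ 0 := by exact_mod_cast hne x hx
    simp only [hu, he']
    field_simp
  have ub : ∀ x ∈ Icc r q, ‖u x * e x‖ ≤ M / (lam * w ^ 2) := fun x hx => by
    rw [norm_mul, ne, mul_one]
    simp only [hu, norm_div, norm_mul, Complex.norm_I, one_mul, Complex.norm_real,
      Real.norm_eq_abs]
    exact div_le_div₀ hM0 (hM x hx) (by positivity) (hlow' x hx)
  have i1 : IntervalIntegrable (fun x => lam⁻¹ * (‖F' x‖ * |x - c|⁻¹)) volume r q :=
    ContinuousOn.intervalIntegrable_of_Icc hrq (by fun_prop (disch := assumption))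
  have i2 : IntervalIntegrable (fun x => M * (ddψ x / dψ x ^ 2)) volume r q :=
    ContinuousOn.intervalIntegrable_of_Icc hrq (by fun_prop (disch := assumption))
  have u'b : ∀ x ∈ Icc r q,
      ‖u' x * e x‖ ≤ lam⁻¹ * (‖F' x‖ * |x - c|⁻¹) + M * (ddψ x / dψ x ^ 2) := fun x hx => by
    rw [norm_mul, ne, mul_one]
    have hx0 := hne x hx
    have hxC := hneC x hx
    have e1 : u' x = F' x / (Complex.I * dψ x) - F x * (Complex.I * ddψ x) /
        (Complex.I * dψ x) ^ 2 := by
      simp only [hu']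
      field_simp
    rw [e1]
    refine (norm_sub_le _ _).trans (add_le_add ?_ ?_)
    · simp only [norm_div, norm_mul, Complex.norm_I, one_mul, Complex.norm_real,
        Real.norm_eq_abs]
      have hxc : 0 < |x - c| := hw2.trans_le (hc x hx)
      calc ‖F' x‖ / |dψ x| ≤ ‖F' x‖ / (lam * |x - c|) :=
            div_le_div_of_nonneg_left (norm_nonneg _) (by positivity) (hlow x hx)
        _ = _ := by field_simp
    · simp only [norm_div, norm_mul, norm_pow, Complex.norm_I, one_mul, Complex.norm_real,
        Real.norm_eq_abs, sq_abs, abs_of_nonneg (hpos x hx)]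
      rw [mul_div_assoc]
      have := hpos x hx
      exact mul_le_mul_of_nonneg_right (hM x hx) (by positivity)
  have cs : ∫ x in r..q, ‖F' x‖ * |x - c|⁻¹ ≤ b * (2 / w) := by
    refine integral_mul_le_of_integral_sq_le hrq (by fun_prop)
      (by fun_prop (disch := assumption)) hb (by positivity) hFb ?_
    refine (integral_inv_sub_sq_le hrq hw2 hc).trans ?_
    rw [div_pow]
    gcongr
    norm_num
  have ftc : ∫ x in r..q, ddψ x / dψ x ^ 2 = (-(dψ q)⁻¹) - (-(dψ r)⁻¹) := by
    refine intervalIntegral.integral_eq_sub_of_hasDerivAt (f := fun x => -(dψ x)⁻¹) ?_ ?_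
    · intro x hx
      rw [Set.uIcc_of_le hrq] at hx
      convert! ((hdψ x hx).fun_inv (hne x hx)).fun_neg using 1
      ring
    · exact ContinuousOn.intervalIntegrable_of_Icc hrq (by fun_prop (disch := assumption))
  have inv_b : ∀ x ∈ Icc r q, |(dψ x)⁻¹| ≤ 1 / (lam * w ^ 2) := fun x hx => by
    rw [abs_inv, ← one_div]
    exact one_div_le_one_div_of_le (by positivity) (hlow' x hx)
  have hr := Set.left_mem_Icc.mpr hrq
  have hq := Set.right_mem_Icc.mpr hrq
  have ftc_le : ∫ x in r..q, ddψ x / dψ x ^ 2 ≤ 2 * (1 / (lam * w ^ 2)) := by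
    rw [ftc]
    have h1 := (abs_le.mp (inv_b q hq)).1
    have h2 := (abs_le.mp (inv_b r hr)).2
    linarith
  have int_b : ‖∫ x in r..q, u' x * e x‖ ≤
      lam⁻¹ * (b * (2 / w)) + M * (2 * (1 / (lam * w ^ 2))) := by
    calc ‖∫ x in r..q, u' x * e x‖ ≤
        ∫ x in r..q, (lam⁻¹ * (‖F' x‖ * |x - c|⁻¹) + M * (ddψ x / dψ x ^ 2)) :=
          intervalIntegral.norm_integral_le_of_norm_le hrq
            (Filter.Eventually.of_forall fun x hx => u'b x (Set.Ioc_subset_Icc_self hx))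
            (i1.add i2)
      _ = lam⁻¹ * (∫ x in r..q, ‖F' x‖ * |x - c|⁻¹) + M * ∫ x in r..q, ddψ x / dψ x ^ 2 := by
          rw [intervalIntegral.integral_add i1 i2, intervalIntegral.integral_const_mul,
            intervalIntegral.integral_const_mul]
      _ ≤ _ := by gcongr
  rw [lhs, ibp]
  calc _ ≤ ‖u q * e q‖ + ‖u r * e r‖ + ‖∫ x in r..q, u' x * e x‖ :=
        (norm_sub_le _ _).trans (add_le_add_left (norm_sub_le _ _) _)
    _ ≤ M / (lam * w ^ 2) + M / (lam * w ^ 2) +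
        (lam⁻¹ * (b * (2 / w)) + M * (2 * (1 / (lam * w ^ 2)))) :=
        add_le_add (add_le_add (ub q hq) (ub r hr)) int_b
    _ = _ := by
        field_simp
        ring

theorem integral_subinterval_le {p q p' q' : ℝ} (hp : p ≤ p') (hpq : p' ≤ q') (hq : q' ≤ q)
    {g : ℝ → ℝ} (hg : ContinuousOn g (Icc p q)) (h0 : ∀ x, 0 ≤ g x) :
    ∫ x in p'..q', g x ≤ ∫ x in p..q, g x :=
  intervalIntegral.integral_mono_interval hp hpq hq (Filter.Eventually.of_forall h0)
    (hg.intervalIntegrable_of_Icc (hp.trans (hpq.trans hq)))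

/-- One-dimensional Sobolev bound on an interval of length at least `a / b`. -/
theorem norm_sq_le_of_integral_sq_le {p q a b : ℝ} (hpq : p < q) (ha : 0 < a) (hb : 0 < b)
    {F F' : ℝ → ℂ} (hF : ∀ x ∈ Icc p q, HasDerivAt F (F' x) x)
    (hF' : ContinuousOn F' (Icc p q)) (hFa : ∫ x in p..q, ‖F x‖ ^ 2 ≤ a ^ 2)
    (hFb : ∫ x in p..q, ‖F' x‖ ^ 2 ≤ b ^ 2) (hab : a ≤ (q - p) * b) {x : ℝ}
    (hx : x ∈ Icc p q) : ‖F x‖ ^ 2 ≤ 4 * (a * b) := by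
  have cF : ContinuousOn F (Icc p q) := fun x hx => (hF x hx).continuousAt.continuousWithinAt
  have cs : ∫ x in p..q, ‖F x‖ * ‖F' x‖ ≤ a * b :=
    integral_mul_le_of_integral_sq_le hpq.le (by fun_prop) (by fun_prop) ha hb hFa hFb
  have osc : ∀ y ∈ Icc p q, ‖F x‖ ^ 2 ≤ ‖F y‖ ^ 2 + 2 * (a * b) := by
    intro y hy
    have hsub : Set.uIcc y x ⊆ Icc p q := Set.uIcc_subset_Icc hy hx
    have ftc : ∫ z in y..x, 2 * inner ℝ (F z) (F' z) = ‖F x‖ ^ 2 - ‖F y‖ ^ 2 := by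
      refine intervalIntegral.integral_eq_sub_of_hasDerivAt (f := fun z => ‖F z‖ ^ 2)
        (fun z hz => (hF z (hsub hz)).norm_sq) ?_
      refine ContinuousOn.intervalIntegrable ?_
      exact (ContinuousOn.inner (𝕜 := ℝ) cF hF').const_smul (2 : ℝ) |>.mono hsub
    have bd : |∫ z in y..x, 2 * inner ℝ (F z) (F' z)| ≤ ∫ z in p..q, 2 * (‖F z‖ * ‖F' z‖) := by
      rw [← Real.norm_eq_abs]
      refine (intervalIntegral.norm_integral_le_abs_of_norm_le
        (g := fun z => 2 * (‖F z‖ * ‖F' z‖)) ?_ ?_).trans ?_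
      · refine Filter.Eventually.of_forall fun z => ?_
        rw [norm_mul, Real.norm_eq_abs, Real.norm_eq_abs, abs_two]
        exact mul_le_mul_of_nonneg_left (abs_real_inner_le_norm _ _) zero_le_two
      · refine ContinuousOn.intervalIntegrable ((?_ : ContinuousOn _ (Icc p q)).mono hsub)
        fun_prop
      · have cg : ContinuousOn (fun z => 2 * (‖F z‖ * ‖F' z‖)) (Icc p q) := by fun_prop
        rcases le_total y x with h | h
        · rw [abs_of_nonneg (intervalIntegral.integral_nonneg h fun z _ => by positivity)]
          exact integral_subinterval_le hy.1 h hx.2 cg fun z => by positivity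
        · rw [intervalIntegral.integral_symm, abs_neg,
            abs_of_nonneg (intervalIntegral.integral_nonneg h fun z _ => by positivity)]
          exact integral_subinterval_le hx.1 h hy.2 cg fun z => by positivity
    rw [ftc, intervalIntegral.integral_const_mul] at bd
    have := (le_abs_self _).trans bd
    linarith
  have avg : (q - p) * ‖F x‖ ^ 2 ≤ a ^ 2 + (q - p) * (2 * (a * b)) := by
    have i1 : IntervalIntegrable (fun y => ‖F y‖ ^ 2) volume p q :=
      ContinuousOn.intervalIntegrable_of_Icc hpq.le (by fun_prop)
    have := intervalIntegral.integral_mono_on (f := fun _ => ‖F x‖ ^ 2)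
      (g := fun y => ‖F y‖ ^ 2 + 2 * (a * b)) hpq.le (by simp) (i1.add (by simp)) osc
    rw [intervalIntegral.integral_add i1 (by simp), intervalIntegral.integral_const,
      intervalIntegral.integral_const, smul_eq_mul, smul_eq_mul] at this
    linarith
  have hL : 0 < q - p := sub_pos.mpr hpq
  have h2 : a ^ 2 ≤ (q - p) * (a * b) := by nlinarith
  have h3 : (q - p) * ‖F x‖ ^ 2 ≤ (q - p) * (4 * (a * b)) := by
    nlinarith [mul_pos hL (mul_pos ha hb)]
  exact le_of_mul_le_mul_left h3 hL

/-- A function whose derivative is at least `lam` vanishes to at most first order at one point. -/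
theorem exists_mul_abs_sub_le_abs {p q lam : ℝ} (hpq : p ≤ q) {g g' : ℝ → ℝ}
    (hg : ∀ x ∈ Icc p q, HasDerivAt g (g' x) x) (hlam : ∀ x ∈ Icc p q, lam ≤ g' x) :
    ∃ c ∈ Icc p q, ∀ x ∈ Icc p q, lam * |x - c| ≤ |g x| := by
  have cg : ContinuousOn g (Icc p q) := fun x hx => (hg x hx).continuousAt.continuousWithinAt
  have mvt : ∀ x ∈ Icc p q, ∀ y ∈ Icc p q, x ≤ y → lam * (y - x) ≤ g y - g x :=
    (convex_Icc p q).mul_sub_le_image_sub_of_le_deriv cg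
      (fun x hx => (hg x (interior_subset hx)).differentiableAt.differentiableWithinAt)
      (fun x hx => by
        rw [(hg x (interior_subset hx)).deriv]
        exact hlam x (interior_subset hx))
  have hp := Set.left_mem_Icc.mpr hpq
  have hq := Set.right_mem_Icc.mpr hpq
  by_cases h1 : 0 ≤ g p
  · refine ⟨p, hp, fun x hx => ?_⟩
    rw [abs_of_nonneg (sub_nonneg.mpr hx.1)]
    exact (by linarith [mvt p hp x hx hx.1] : _ ≤ g x).trans (le_abs_self _)
  by_cases h2 : g q ≤ 0
  · refine ⟨q, hq, fun x hx => ?_⟩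
    rw [abs_sub_comm, abs_of_nonneg (sub_nonneg.mpr hx.2)]
    exact (by linarith [mvt x hx q hq hx.2] : _ ≤ -g x).trans (neg_le_abs _)
  obtain ⟨c, hc, hc0⟩ := intermediate_value_Icc hpq cg ⟨(not_le.mp h1).le, (not_le.mp h2).le⟩
  refine ⟨c, hc, fun x hx => ?_⟩
  rcases le_total c x with h | h
  · rw [abs_of_nonneg (sub_nonneg.mpr h)]
    exact (by linarith [mvt c hc x hx h] : _ ≤ g x).trans (le_abs_self _)
  · rw [abs_sub_comm, abs_of_nonneg (sub_nonneg.mpr h)]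
    exact (by linarith [mvt x hx c hc h] : _ ≤ -g x).trans (neg_le_abs _)

/-- Localisation of an oscillatory integral to a neighbourhood of the stationary point. -/
theorem exists_norm_integral_le_stationary {p q lam w M b : ℝ} (hpq : p ≤ q) (hlam : 0 < lam)
    (hw : 0 < w) (hb : 0 < b) {ψ dψ ddψ : ℝ → ℝ} {F F' : ℝ → ℂ}
    (hψ : ∀ x ∈ Icc p q, HasDerivAt ψ (dψ x) x) (hdψ : ∀ x ∈ Icc p q, HasDerivAt dψ (ddψ x) x)
    (hddψ : ContinuousOn ddψ (Icc p q)) (hlow : ∀ x ∈ Icc p q, lam ≤ ddψ x)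
    (hF : ∀ x ∈ Icc p q, HasDerivAt F (F' x) x) (hF' : ContinuousOn F' (Icc p q))
    (hM : ∀ x ∈ Icc p q, ‖F x‖ ≤ M) (hFb : ∫ x in p..q, ‖F' x‖ ^ 2 ≤ b ^ 2) :
    ∃ p' q', p ≤ p' ∧ p' ≤ q' ∧ q' ≤ q ∧ q' - p' ≤ 2 * w ^ 2 ∧
      ‖∫ x in p..q, Complex.exp (Complex.I * ψ x) * F x‖ ≤
        ‖∫ x in p'..q', Complex.exp (Complex.I * ψ x) * F x‖ +
          2 * (4 * M / (lam * w ^ 2) + 2 * b / (lam * w)) := by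
  obtain ⟨c, hc, hcl⟩ := exists_mul_abs_sub_le_abs hpq hdψ hlow
  have hw2 : 0 < w ^ 2 := by positivity
  have hM0 : 0 ≤ M := (norm_nonneg _).trans (hM p (Set.left_mem_Icc.mpr hpq))
  have side : ∀ r s, p ≤ r → r ≤ s → s ≤ q → (r < s → ∀ x ∈ Icc r s, w ^ 2 ≤ |x - c|) →
      ‖∫ x in r..s, Complex.exp (Complex.I * ψ x) * F x‖ ≤
        4 * M / (lam * w ^ 2) + 2 * b / (lam * w) := by
    intro r s hr hrs hs hcs
    rcases hrs.eq_or_lt with rfl | hlt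
    · simp only [intervalIntegral.integral_same, norm_zero]
      positivity
    have hsub : Icc r s ⊆ Icc p q := Set.Icc_subset_Icc hr hs
    exact norm_integral_nonstationary_le hrs hlam hw hb (fun x hx => hψ x (hsub hx))
      (fun x hx => hdψ x (hsub hx)) (hddψ.mono hsub)
      (fun x hx => hlam.le.trans (hlow x (hsub hx))) (fun x hx => hF x (hsub hx))
      (hF'.mono hsub) (fun x hx => hcl x (hsub hx)) (hcs hlt) (fun x hx => hM x (hsub hx))
      ((integral_subinterval_le hr hrs hs (by fun_prop) fun x => by positivity).trans hFb)
  have hp'c : max p (c - w ^ 2) ≤ c := max_le hc.1 (by linarith)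
  have hcq' : c ≤ min q (c + w ^ 2) := le_min hc.2 (by linarith)
  have hpq' := hp'c.trans hcq'
  refine ⟨max p (c - w ^ 2), min q (c + w ^ 2), le_max_left _ _, hpq', min_le_left _ _, ?_, ?_⟩
  · linarith [le_max_right p (c - w ^ 2), min_le_right q (c + w ^ 2)]
  have cψ : ContinuousOn ψ (Icc p q) := fun x hx => (hψ x hx).continuousAt.continuousWithinAt
  have cF : ContinuousOn F (Icc p q) := fun x hx => (hF x hx).continuousAt.continuousWithinAt
  have ii : ∀ r s, r ∈ Icc p q → s ∈ Icc p q →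
      IntervalIntegrable (fun x => Complex.exp (Complex.I * ψ x) * F x) volume r s := by
    intro r s hr hs
    refine ContinuousOn.intervalIntegrable
      ((?_ : ContinuousOn _ (Icc p q)).mono (Set.uIcc_subset_Icc hr hs))
    fun_prop
  have mp : p ∈ Icc p q := Set.left_mem_Icc.mpr hpq
  have mq : q ∈ Icc p q := Set.right_mem_Icc.mpr hpq
  have mp' : max p (c - w ^ 2) ∈ Icc p q := ⟨le_max_left _ _, hp'c.trans hc.2⟩
  have mq' : min q (c + w ^ 2) ∈ Icc p q := ⟨hc.1.trans hcq', min_le_left _ _⟩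
  have split := intervalIntegral.integral_add_adjacent_intervals (ii _ _ mp mp') (ii _ _ mp' mq')
  have split' := intervalIntegral.integral_add_adjacent_intervals (ii _ _ mp mq') (ii _ _ mq' mq)
  have left := side p (max p (c - w ^ 2)) le_rfl mp'.1 mp'.2 fun hlt x hx => by
    have : max p (c - w ^ 2) = c - w ^ 2 :=
      max_eq_right ((lt_max_iff.mp hlt).resolve_left (lt_irrefl _)).le
    rw [this] at hx
    rw [abs_sub_comm]
    exact (by linarith [hx.2] : _ ≤ c - x).trans (le_abs_self _)
  have right := side (min q (c + w ^ 2)) q mq'.1 mq'.2 le_rfl fun hlt x hx => by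
    have : min q (c + w ^ 2) = c + w ^ 2 :=
      min_eq_right ((min_lt_iff.mp hlt).resolve_left (lt_irrefl _)).le
    rw [this] at hx
    exact (by linarith [hx.1] : _ ≤ x - c).trans (le_abs_self _)
  rw [← split', ← split]
  refine (norm_add_le _ _).trans ((add_le_add_left (norm_add_le _ _) _).trans ?_)
  linarith

/-- Second-derivative van der Corput estimate with amplitude controlled in `L²` together with its
derivative; here `∫ |F|² ≤ A⁴`, `∫ |F'|² ≤ B⁴` and the second derivative of the phase is at least
`N⁴`. -/
theorem norm_integral_le_of_second_deriv {p q A B N : ℝ} (hpq : p < q) (hA : 0 < A) (hB : 0 < B)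
    (hN : 0 < N) {ψ dψ ddψ : ℝ → ℝ} {F F' : ℝ → ℂ}
    (hψ : ∀ x ∈ Icc p q, HasDerivAt ψ (dψ x) x) (hdψ : ∀ x ∈ Icc p q, HasDerivAt dψ (ddψ x) x)
    (hddψ : ContinuousOn ddψ (Icc p q)) (hlow : ∀ x ∈ Icc p q, N ^ 4 ≤ ddψ x)
    (hF : ∀ x ∈ Icc p q, HasDerivAt F (F' x) x) (hF' : ContinuousOn F' (Icc p q))
    (hFa : ∫ x in p..q, ‖F x‖ ^ 2 ≤ (A ^ 2) ^ 2) (hFb : ∫ x in p..q, ‖F' x‖ ^ 2 ≤ (B ^ 2) ^ 2)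
    (hAB : A ^ 2 ≤ (q - p) * B ^ 2) :
    ‖∫ x in p..q, Complex.exp (Complex.I * ψ x) * F x‖ ≤ 24 * (A * B / N ^ 2) := by
  have hM : ∀ x ∈ Icc p q, ‖F x‖ ≤ 2 * (A * B) := fun x hx => by
    have := norm_sq_le_of_integral_sq_le hpq (by positivity) (by positivity) hF hF' hFa hFb hAB hx
    refine le_of_sq_le_sq (this.trans_eq ?_) (by positivity)
    ring
  have cF : ContinuousOn F (Icc p q) := fun x hx => (hF x hx).continuousAt.continuousWithinAt
  have ne : ∀ x, ‖Complex.exp (Complex.I * ψ x) * F x‖ = ‖F x‖ := fun x => by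
    rw [norm_mul, mul_comm Complex.I, Complex.norm_exp_ofReal_mul_I, one_mul]
  rcases le_total (N * A) B with hcase | hcase
  · obtain ⟨p', q', hp', hpq', hq', hlen, hle⟩ := exists_norm_integral_le_stationary
      (w := B / (N ^ 2 * A)) hpq.le (by positivity : 0 < N ^ 4) (by positivity)
      (by positivity : 0 < B ^ 2) hψ hdψ hddψ hlow hF hF' hM hFb
    have hsub : Icc p' q' ⊆ Icc p q := Set.Icc_subset_Icc hp' hq'
    have mid : ‖∫ x in p'..q', Complex.exp (Complex.I * ψ x) * F x‖ ≤
        A ^ 2 * (2 * (B / (N ^ 2 * A))) := by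
      calc _ ≤ ∫ x in p'..q', ‖Complex.exp (Complex.I * ψ x) * F x‖ :=
            intervalIntegral.norm_integral_le_integral_norm hpq'
        _ = ∫ x in p'..q', ‖F x‖ * 1 := by simp only [ne, mul_one]
        _ ≤ _ := by
          refine integral_mul_le_of_integral_sq_le hpq' (cF.mono hsub).norm (by fun_prop)
            (by positivity) (by positivity)
            ((integral_subinterval_le hp' hpq' hq' (by fun_prop) fun x => by positivity).trans
              hFa) ?_
          simp only [one_pow, intervalIntegral.integral_const, smul_eq_mul, mul_one]
          have : 0 < (B / (N ^ 2 * A)) ^ 2 := by positivity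
          linarith [mul_pow 2 (B / (N ^ 2 * A)) 2]
    have e1 : A ^ 2 * (2 * (B / (N ^ 2 * A))) = 2 * (A * B / N ^ 2) := by field_simp
    have e2 : 4 * (2 * (A * B)) / (N ^ 4 * (B / (N ^ 2 * A)) ^ 2) = 8 * (A ^ 3 / B) := by
      field_simp
      ring
    have e3 : 2 * B ^ 2 / (N ^ 4 * (B / (N ^ 2 * A))) = 2 * (A * B / N ^ 2) := by
      field_simp
    have e4 : A ^ 3 / B ≤ A * B / N ^ 2 := by
      rw [div_le_div_iff₀ hB (by positivity)]
      have : (N * A) ^ 2 ≤ B ^ 2 := pow_le_pow_left₀ (by positivity) hcase 2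
      nlinarith
    have e5 : 0 < A * B / N ^ 2 := by positivity
    rw [e2, e3] at hle
    rw [e1] at mid
    linarith
  · obtain ⟨p', q', hp', hpq', hq', hlen, hle⟩ := exists_norm_integral_le_stationary
      (w := 1 / N) hpq.le (by positivity : 0 < N ^ 4) (by positivity)
      (by positivity : 0 < B ^ 2) hψ hdψ hddψ hlow hF hF' hM hFb
    have hsub : Icc p' q' ⊆ Icc p q := Set.Icc_subset_Icc hp' hq'
    have mid : ‖∫ x in p'..q', Complex.exp (Complex.I * ψ x) * F x‖ ≤
        2 * (A * B) * (2 * (1 / N) ^ 2) := by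
      refine (intervalIntegral.norm_integral_le_of_norm_le_const (C := 2 * (A * B))
        fun x hx => ?_).trans ?_
      · rw [ne]
        rw [Set.uIoc_of_le hpq'] at hx
        exact hM x (hsub (Set.Ioc_subset_Icc_self hx))
      · rw [abs_of_nonneg (sub_nonneg.mpr hpq')]
        gcongr
    have e1 : 2 * (A * B) * (2 * (1 / N) ^ 2) = 4 * (A * B / N ^ 2) := by
      field_simp
      ring
    have e2 : 4 * (2 * (A * B)) / (N ^ 4 * (1 / N) ^ 2) = 8 * (A * B / N ^ 2) := by
      field_simp
      ring
    have e3 : 2 * B ^ 2 / (N ^ 4 * (1 / N)) ≤ 2 * (A * B / N ^ 2) := by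
      have : 2 * B ^ 2 / (N ^ 4 * (1 / N)) = 2 * (B ^ 2 / N ^ 3) := by field_simp
      rw [this]
      refine mul_le_mul_of_nonneg_left ?_ zero_le_two
      rw [div_le_div_iff₀ (by positivity) (by positivity)]
      nlinarith [mul_le_mul_of_nonneg_left hcase (by positivity : 0 ≤ B * N ^ 2)]
    rw [e2] at hle
    rw [e1] at mid
    linarith

theorem integral_dyadic_le_of_integral_le {g : ℝ → ℝ} {K R : ℝ} (hR : 0 < R)
    (h0 : ∀ x, 0 ≤ g x) (hg : Integrable g) (hK : ∫ x, g x ≤ K) :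
    ∫ x in R..(2 * R), g x ≤ K := by
  rw [intervalIntegral.integral_of_le (by linarith)]
  exact (setIntegral_le_integral hg (Filter.Eventually.of_forall h0)).trans hK

theorem integral_dyadic_le_of_integral_mul_sq_le {g : ℝ → ℝ} {K R : ℝ} (hR : 0 < R)
    (h0 : ∀ x, 0 ≤ g x) (cg : Continuous g) (hg : Integrable fun x => x ^ 2 * g x)
    (hK : ∫ x, x ^ 2 * g x ≤ K ^ 2) : ∫ x in R..(2 * R), g x ≤ (K / R) ^ 2 := by
  have h2 := integral_dyadic_le_of_integral_le hR (fun x => mul_nonneg (sq_nonneg x) (h0 x)) hg hK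
  have h3 : R ^ 2 * ∫ x in R..(2 * R), g x ≤ ∫ x in R..(2 * R), x ^ 2 * g x := by
    rw [← intervalIntegral.integral_const_mul]
    refine intervalIntegral.integral_mono_on (by linarith)
      (Continuous.intervalIntegrable (by fun_prop) _ _)
      (Continuous.intervalIntegrable (by fun_prop) _ _) fun x hx => ?_
    exact mul_le_mul_of_nonneg_right (pow_le_pow_left₀ hR.le hx.1 2) (h0 x)
  rw [div_pow, le_div_iff₀ (by positivity)]
  linarith

theorem min_mul_rpow_le {α R : ℝ} (hα₁ : 1 / 3 < α) (hα₂ : α < 1 / 2) (hR : 0 < R) :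
    min 1 R⁻¹ * R⁻¹ * R ^ (2 - α) ≤ ((min R R⁻¹) ^ (1 / 6 : ℝ)) ^ 2 := by
  have e0 : R⁻¹ = R ^ (-1 : ℝ) := (Real.rpow_neg_one R).symm
  have hmin : 0 < min R R⁻¹ := lt_min hR (by positivity)
  rw [← Real.rpow_mul_natCast hmin.le]
  rcases le_total R 1 with h1 | h1
  · have h2 := (one_le_inv₀ hR).mpr h1
    rw [min_eq_left h2, min_eq_left (h1.trans h2), one_mul, e0, ← Real.rpow_add hR]
    exact Real.rpow_le_rpow_of_exponent_ge hR h1 (by norm_num; linarith)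
  · have h2 := inv_le_one_of_one_le₀ h1
    rw [min_eq_right h2, min_eq_right (h2.trans h1), e0, ← Real.rpow_add hR, ← Real.rpow_add hR,
      ← Real.rpow_mul hR.le]
    exact Real.rpow_le_rpow_of_exponent_le h1 (by norm_num; linarith)

/-- `f` is a `C¹` function with derivative `f'`, and `f`, `ξ f`, `ξ f'` all have `L²` norm at most
`A`. -/
structure WeightedL2Bound (f f' : ℝ → ℂ) (A : ℝ) : Prop where
  hasDerivAt : ∀ x, HasDerivAt f (f' x) x
  continuous_deriv : Continuous f'
  integrable_sq : Integrable fun x => ‖f x‖ ^ 2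
  integral_sq_le : ∫ x, ‖f x‖ ^ 2 ≤ A ^ 2
  integrable_mul_sq : Integrable fun x => x ^ 2 * ‖f x‖ ^ 2
  integral_mul_sq_le : ∫ x, x ^ 2 * ‖f x‖ ^ 2 ≤ A ^ 2
  integrable_mul_deriv_sq : Integrable fun x => x ^ 2 * ‖f' x‖ ^ 2
  integral_mul_deriv_sq_le : ∫ x, x ^ 2 * ‖f' x‖ ^ 2 ≤ A ^ 2

namespace WeightedL2Bound

variable {f f' : ℝ → ℂ} {A : ℝ}

theorem continuous (h : WeightedL2Bound f f' A) : Continuous f :=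
  continuous_iff_continuousAt.mpr fun x => (h.hasDerivAt x).continuousAt

theorem comp_neg (h : WeightedL2Bound f f' A) :
    WeightedL2Bound (fun x => f (-x)) (fun x => -f' (-x)) A where
  hasDerivAt x := by
    simpa [Function.comp_def] using (h.hasDerivAt (-x)).scomp x (hasDerivAt_neg x)
  continuous_deriv := (h.continuous_deriv.comp continuous_neg).neg
  integrable_sq := h.integrable_sq.comp_neg
  integral_sq_le :=
    (integral_neg_eq_self (fun x => ‖f x‖ ^ 2) volume).trans_le h.integral_sq_le
  integrable_mul_sq := by simpa using h.integrable_mul_sq.comp_neg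
  integral_mul_sq_le := by
    simpa using
      (integral_neg_eq_self (fun x => x ^ 2 * ‖f x‖ ^ 2) volume).trans_le h.integral_mul_sq_le
  integrable_mul_deriv_sq := by simpa using h.integrable_mul_deriv_sq.comp_neg
  integral_mul_deriv_sq_le := by
    simpa using (integral_neg_eq_self (fun x => x ^ 2 * ‖f' x‖ ^ 2) volume).trans_le
      h.integral_mul_deriv_sq_le

theorem conj (h : WeightedL2Bound f f' A) :
    WeightedL2Bound (fun x => (starRingEnd ℂ) (f x)) (fun x => (starRingEnd ℂ) (f' x)) A where
  hasDerivAt x := (h.hasDerivAt x).star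
  continuous_deriv := Complex.continuous_conj.comp h.continuous_deriv
  integrable_sq := by simpa using h.integrable_sq
  integral_sq_le := by simpa using h.integral_sq_le
  integrable_mul_sq := by simpa using h.integrable_mul_sq
  integral_mul_sq_le := by simpa using h.integral_mul_sq_le
  integrable_mul_deriv_sq := by simpa using h.integrable_mul_deriv_sq
  integral_mul_deriv_sq_le := by simpa using h.integral_mul_deriv_sq_le

theorem dyadic_sq_le (h : WeightedL2Bound f f' A) {R : ℝ} (hR : 0 < R) :
    ∫ x in R..(2 * R), ‖f x‖ ^ 2 ≤ (A * min 1 R⁻¹) ^ 2 := by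
  rcases min_cases 1 R⁻¹ with ⟨e, -⟩ | ⟨e, -⟩
  · rw [e, mul_one]
    exact integral_dyadic_le_of_integral_le hR (fun x => by positivity) h.integrable_sq
      h.integral_sq_le
  · rw [e, ← div_eq_mul_inv]
    have := h.continuous
    exact integral_dyadic_le_of_integral_mul_sq_le hR (fun x => by positivity) (by fun_prop)
      h.integrable_mul_sq h.integral_mul_sq_le

theorem dyadic_deriv_sq_le (h : WeightedL2Bound f f' A) {R : ℝ} (hR : 0 < R) :
    ∫ x in R..(2 * R), ‖f' x‖ ^ 2 ≤ (A / R) ^ 2 := by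
  have := h.continuous_deriv
  exact integral_dyadic_le_of_integral_mul_sq_le hR (fun x => by positivity) (by fun_prop)
    h.integrable_mul_deriv_sq h.integral_mul_deriv_sq_le

theorem norm_dyadic_le (h : WeightedL2Bound f f' A) (hA : 0 < A) {R : ℝ} (hR : 0 < R)
    (ψ : ℝ → ℝ) :
    ‖∫ x in R..(2 * R), Complex.exp (Complex.I * ψ x) * f x‖ ≤ A * (min R R⁻¹) ^ (1 / 6 : ℝ) := by
  have hR2 : R ≤ 2 * R := by linarith
  have hm : 0 < min 1 R⁻¹ := lt_min one_pos (by positivity)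
  have hmin : 0 < min R R⁻¹ := lt_min hR (by positivity)
  have cf := h.continuous
  calc ‖∫ x in R..(2 * R), Complex.exp (Complex.I * ψ x) * f x‖
      ≤ ∫ x in R..(2 * R), ‖Complex.exp (Complex.I * ψ x) * f x‖ :=
        intervalIntegral.norm_integral_le_integral_norm hR2
    _ = ∫ x in R..(2 * R), ‖f x‖ * 1 := by
        simp only [norm_mul, mul_comm Complex.I, Complex.norm_exp_ofReal_mul_I, one_mul, mul_one]
    _ ≤ A * min 1 R⁻¹ * √R := by
        refine integral_mul_le_of_integral_sq_le hR2 (by fun_prop) (by fun_prop) (by positivity)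
          (by positivity) (h.dyadic_sq_le hR) ?_
        simp only [one_pow, intervalIntegral.integral_const, smul_eq_mul, mul_one,
          Real.sq_sqrt hR.le]
        linarith
    _ = A * (min R R⁻¹) ^ (1 / 2 : ℝ) := by
        rw [mul_assoc, ← Real.sqrt_eq_rpow]
        congr 1
        rcases le_total R 1 with h1 | h1
        · have h2 := (one_le_inv₀ hR).mpr h1
          rw [min_eq_left h2, min_eq_left (h1.trans h2), one_mul]
        · have h2 := inv_le_one_of_one_le₀ h1
          rw [min_eq_right h2, min_eq_right (h2.trans h1), Real.sqrt_inv]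
          have := Real.mul_self_sqrt hR.le
          have h3 : √R ≠ 0 := by positivity
          field_simp
          linarith
    _ ≤ _ := by
        gcongr ?_ * ?_
        refine Real.rpow_le_rpow_of_exponent_ge hmin ?_ (by norm_num)
        rcases le_total R 1 with h1 | h1
        · exact (min_le_left _ _).trans h1
        · exact (min_le_right _ _).trans (inv_le_one_of_one_le₀ h1)

theorem norm_dyadic_phase_le_of_neg (h : WeightedL2Bound f f' A) (hA : 0 < A) {α : ℝ}
    (hα₁ : 1 / 3 < α) (hα₂ : α < 1 / 2) {R : ℝ} (hR : 0 < R) {t : ℝ} (ht : t ≤ -1) (y : ℝ) :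
    ‖∫ x in R..(2 * R), Complex.exp (Complex.I * ((t * x ^ α + y * x : ℝ) : ℂ)) * f x‖ ≤
      144 * (A * (1 + |t|) ^ (-(1 : ℝ) / 2) * (min R R⁻¹) ^ (1 / 6 : ℝ)) := by
  have hm : 0 < min 1 R⁻¹ := lt_min one_pos (by positivity)
  have hmin : 0 < min R R⁻¹ := lt_min hR (by positivity)
  set S := (1 + |t|) ^ (-(1 : ℝ) / 2) with hS
  set ρ := (min R R⁻¹) ^ (1 / 6 : ℝ) with hρ
  have hS0 : 0 < S := by positivity
  have hρ0 : 0 < ρ := by positivity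
  have hT : |t| = -t := abs_of_nonpos (by linarith)
  have hS2 : S ^ 2 = (1 + |t|)⁻¹ := by
    rw [hS, ← Real.rpow_mul_natCast (by positivity), ← Real.rpow_neg_one]
    norm_num
  set lam := -t * R ^ (α - 2) / 18 with hlam
  have hlam0 : 0 < lam := by
    have : 0 < -t := by linarith
    positivity
  set a := √(A * min 1 R⁻¹) with ha
  set b := √(A / R) with hb
  have ha2 : a ^ 2 = A * min 1 R⁻¹ := Real.sq_sqrt (by positivity)
  have hb2 : b ^ 2 = A / R := Real.sq_sqrt (by positivity)
  have hN2 : (√√lam) ^ 2 = √lam := Real.sq_sqrt (by positivity)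
  have hN4 : (√√lam) ^ 4 = lam := by
    rw [show 4 = 2 * 2 from rfl, pow_mul, hN2, Real.sq_sqrt hlam0.le]
  have ha0 : 0 < a := by positivity
  have hb0 : 0 < b := by positivity
  have hN0 : 0 < √√lam := by positivity
  have hpos : ∀ x ∈ Icc R (2 * R), 0 < x := fun x hx => hR.trans_le hx.1
  have key := norm_integral_le_of_second_deriv (p := R) (q := 2 * R) (by linarith) ha0 hb0
    hN0 (F := f) (F' := f')
    (ψ := fun x => t * x ^ α + y * x) (dψ := fun x => t * (α * x ^ (α - 1)) + y)
    (ddψ := fun x => t * (α * ((α - 1) * x ^ (α - 1 - 1))))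
    (fun x hx => by
      have h1 := (Real.hasDerivAt_rpow_const (p := α) (Or.inl (hpos x hx).ne')).const_mul t
      simpa using h1.fun_add ((hasDerivAt_id x).const_mul y))
    (fun x hx => by
      have h1 := (Real.hasDerivAt_rpow_const (p := α - 1) (Or.inl (hpos x hx).ne'))
      exact ((h1.const_mul α).const_mul t).add_const y)
    (by
      have : ∀ x ∈ Icc R (2 * R), x ≠ 0 ∨ 0 ≤ α - 1 - 1 := fun x hx => Or.inl (hpos x hx).ne'
      have h1 : ContinuousOn (fun x : ℝ => x ^ (α - 1 - 1)) (Icc R (2 * R)) :=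
        continuousOn_id.rpow_const this
      fun_prop)
    (fun x hx => by
      have hx0 := hpos x hx
      have e1 : α - 1 - 1 = α - 2 := by ring
      rw [hN4, hlam, e1]
      have h1 : (2 * R) ^ (α - 2) ≤ x ^ (α - 2) :=
        Real.rpow_le_rpow_of_nonpos hx0 hx.2 (by linarith)
      rw [Real.mul_rpow zero_le_two hR.le] at h1
      have h2 : (1 / 4 : ℝ) ≤ 2 ^ (α - 2) := by
        have : (2 : ℝ) ^ (-2 : ℝ) ≤ 2 ^ (α - 2) :=
          Real.rpow_le_rpow_of_exponent_le one_le_two (by linarith)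
        refine le_trans (le_of_eq ?_) this
        rw [Real.rpow_neg zero_le_two]
        norm_num
      have hRp : 0 < R ^ (α - 2) := by positivity
      have h3 : 1 / 4 * R ^ (α - 2) ≤ x ^ (α - 2) :=
        (mul_le_mul_of_nonneg_right h2 hRp.le).trans h1
      have h4 : 2 / 9 ≤ α * (1 - α) := by nlinarith
      have h5 : 2 / 9 * (1 / 4 * R ^ (α - 2)) ≤ α * (1 - α) * x ^ (α - 2) :=
        mul_le_mul h4 h3 (by positivity) (by nlinarith)
      have h6 := mul_le_mul_of_nonneg_left h5 (by linarith : 0 ≤ -t)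
      linarith)
    (fun x _ => h.hasDerivAt x) h.continuous_deriv.continuousOn
    (by rw [ha2]; exact h.dyadic_sq_le hR) (by rw [hb2]; exact h.dyadic_deriv_sq_le hR)
    (by
      rw [ha2, hb2, show (2 * R - R) * (A / R) = A * 1 by field_simp; ring]
      gcongr
      exact min_le_left _ _)
  refine key.trans ?_
  have hfin : a * b / (√√lam) ^ 2 ≤ 6 * (A * S * ρ) := by
    refine le_of_sq_le_sq ?_ (by positivity)
    rw [hN2, div_pow, mul_pow, ha2, hb2, Real.sq_sqrt hlam0.le]
    have hRinv : R ^ (α - 2) * R ^ (2 - α) = 1 := by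
      rw [← Real.rpow_add hR]
      simp
    have hRp : 0 < R ^ (α - 2) := by positivity
    have h1 := min_mul_rpow_le hα₁ hα₂ hR
    rw [← hρ] at h1
    have e1 : (6 * (A * S * ρ)) ^ 2 = 36 * A ^ 2 * (1 + |t|)⁻¹ * ρ ^ 2 := by
      rw [← hS2]
      ring
    rw [e1, div_le_iff₀ hlam0]
    have h2 : 1 / 2 ≤ (1 + |t|)⁻¹ * (-t) := by
      rw [hT, inv_mul_eq_div, div_le_div_iff₀ two_pos (by linarith)]
      linarith
    have h3 : min 1 R⁻¹ * R⁻¹ ≤ ρ ^ 2 * R ^ (α - 2) := by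
      have := mul_le_mul_of_nonneg_right h1 hRp.le
      rwa [mul_assoc, mul_comm (R ^ (2 - α)), hRinv, mul_one] at this
    calc A * min 1 R⁻¹ * (A / R) = A ^ 2 * (min 1 R⁻¹ * R⁻¹) := by
          rw [div_eq_mul_inv]
          ring
      _ ≤ A ^ 2 * (ρ ^ 2 * R ^ (α - 2)) := by gcongr
      _ = 2 * (A ^ 2 * (ρ ^ 2 * R ^ (α - 2))) * (1 / 2) := by ring
      _ ≤ 2 * (A ^ 2 * (ρ ^ 2 * R ^ (α - 2))) * ((1 + |t|)⁻¹ * (-t)) := by gcongr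
      _ = _ := by
          rw [hlam]
          ring
  linarith

theorem norm_dyadic_phase_le (h : WeightedL2Bound f f' A) (hA : 0 < A) {α : ℝ}
    (hα₁ : 1 / 3 < α) (hα₂ : α < 1 / 2) {R : ℝ} (hR : 0 < R) (t y : ℝ) :
    ‖∫ x in R..(2 * R), Complex.exp (Complex.I * ((t * x ^ α + y * x : ℝ) : ℂ)) * f x‖ ≤
      144 * (A * (1 + |t|) ^ (-(1 : ℝ) / 2) * (min R R⁻¹) ^ (1 / 6 : ℝ)) := by
  rcases le_total t (-1) with ht | ht
  · exact h.norm_dyadic_phase_le_of_neg hA hα₁ hα₂ hR ht y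
  rcases le_total 1 t with ht' | ht'
  · have key := h.conj.norm_dyadic_phase_le_of_neg hA hα₁ hα₂ hR (neg_le_neg ht') (-y)
    rw [abs_neg] at key
    refine le_of_eq_of_le ?_ key
    have hR2 : R ≤ 2 * R := by linarith
    rw [← RCLike.norm_conj, intervalIntegral.integral_of_le hR2,
      intervalIntegral.integral_of_le hR2, ← integral_conj]
    congr 1
    refine integral_congr_ae (Filter.Eventually.of_forall fun x => ?_)
    simp only [map_mul, ← Complex.exp_conj, Complex.conj_I, Complex.conj_ofReal]
    congr 2
    push_cast
    ring
  · refine (h.norm_dyadic_le hA hR _).trans ?_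
    have hmin : 0 < min R R⁻¹ := lt_min hR (by positivity)
    have ht1 : |t| ≤ 1 := abs_le.mpr ⟨ht, ht'⟩
    have h1 : (1 / 2 : ℝ) ≤ (1 + |t|) ^ (-(1 : ℝ) / 2) := by
      calc (1 / 2 : ℝ) = 2 ^ (-1 : ℝ) := by rw [Real.rpow_neg_one]; norm_num
        _ ≤ 2 ^ (-(1 : ℝ) / 2) := Real.rpow_le_rpow_of_exponent_le one_le_two (by norm_num)
        _ ≤ _ := Real.rpow_le_rpow_of_nonpos (by positivity) (by linarith) (by norm_num)
    have h2 : 0 < A * (min R R⁻¹) ^ (1 / 6 : ℝ) := by positivity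
    nlinarith

end WeightedL2Bound

/-- Summation of a geometric family of bounds on dyadic intervals. -/
theorem norm_integral_Ioi_le_of_dyadic {g : ℝ → ℂ} (hg : Integrable g) {K r : ℝ} (hK : 0 ≤ K)
    (hr0 : 0 ≤ r) (hr1 : r < 1)
    (hup : ∀ k : ℕ, ‖∫ x in (2 : ℝ) ^ k..2 * (2 : ℝ) ^ k, g x‖ ≤ K * r ^ k)
    (hdown : ∀ k : ℕ, ‖∫ x in (2⁻¹ : ℝ) ^ k..2 * (2⁻¹ : ℝ) ^ k, g x‖ ≤ K * r ^ k) :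
    ‖∫ x in Ioi 0, g x‖ ≤ 2 * (K * (1 - r)⁻¹) := by
  have ii : ∀ a b, IntervalIntegrable g volume a b := fun a b => hg.intervalIntegrable
  have geom : ∀ n : ℕ, ∑ k ∈ Finset.range n, K * r ^ k ≤ K * (1 - r)⁻¹ := fun n => by
    rw [← Finset.mul_sum]
    refine mul_le_mul_of_nonneg_left ?_ hK
    rw [← tsum_geometric_of_lt_one hr0 hr1]
    exact (summable_geometric_of_lt_one hr0 hr1).sum_le_tsum _ fun i _ => by positivity
  have high : ∀ n : ℕ, ‖∫ x in (1 : ℝ)..2 ^ n, g x‖ ≤ ∑ k ∈ Finset.range n, K * r ^ k := by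
    intro n
    induction n with
    | zero => simp
    | succ n ih =>
      rw [Finset.sum_range_succ, pow_succ', ← intervalIntegral.integral_add_adjacent_intervals
        (ii 1 (2 ^ n)) (ii (2 ^ n) _)]
      exact (norm_add_le _ _).trans (add_le_add ih (hup n))
  have h1 : ‖∫ x in Ioi 1, g x‖ ≤ K * (1 - r)⁻¹ :=
    le_of_tendsto (intervalIntegral_tendsto_integral_Ioi 1 hg.integrableOn
      (tendsto_pow_atTop_atTop_of_one_lt one_lt_two)).norm
      (Filter.Eventually.of_forall fun n => (high n).trans (geom n))
  have hlim : Filter.Tendsto (fun n : ℕ => ∫ x in (2⁻¹ : ℝ) ^ n..1, g x) Filter.atTop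
      (nhds (∫ x in (0 : ℝ)..1, g x)) := by
    have hc : Continuous fun a => ∫ x in (1 : ℝ)..a, g x :=
      intervalIntegral.continuous_primitive ii 1
    have := (hc.tendsto 0).comp
      (tendsto_pow_atTop_nhds_zero_of_lt_one (by norm_num : (0 : ℝ) ≤ 2⁻¹) (by norm_num))
    have h2 := this.neg
    rw [← intervalIntegral.integral_symm] at h2
    refine h2.congr fun n => ?_
    exact (intervalIntegral.integral_symm _ _).symm
  have low : ∀ n : ℕ, ‖∫ x in (2⁻¹ : ℝ) ^ n..1, g x‖ ≤ ∑ k ∈ Finset.range n, K * r ^ k := by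
    intro n
    induction n with
    | zero => simp
    | succ n ih =>
      have e : 2 * (2⁻¹ : ℝ) ^ (n + 1) = 2⁻¹ ^ n := by
        rw [pow_succ]
        ring
      have hd := hdown (n + 1)
      rw [e] at hd
      rw [Finset.sum_range_succ, ← intervalIntegral.integral_add_adjacent_intervals
        (ii (2⁻¹ ^ (n + 1)) (2⁻¹ ^ n)) (ii (2⁻¹ ^ n) _), add_comm]
      refine (norm_add_le _ _).trans (add_le_add ih (hd.trans ?_))
      exact mul_le_mul_of_nonneg_left (pow_le_pow_of_le_one hr0 hr1.le n.le_succ) hK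
  have h2 : ‖∫ x in (0 : ℝ)..1, g x‖ ≤ K * (1 - r)⁻¹ :=
    le_of_tendsto hlim.norm (Filter.Eventually.of_forall fun n => (low n).trans (geom n))
  rw [← intervalIntegral.integral_interval_add_Ioi hg.integrableOn hg.integrableOn (b := 1)]
  refine (norm_add_le _ _).trans ?_
  linarith

theorem integrable_exp_mul {f : ℝ → ℂ} (hf : Integrable f) (ψ : ℝ → ℝ)
    (hψ : Continuous ψ) :
    Integrable fun x => Complex.exp (Complex.I * ψ x) * f x := by
  refine hf.bdd_mul (c := 1) (by fun_prop) (Filter.Eventually.of_forall fun x => ?_)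
  rw [mul_comm, Complex.norm_exp_ofReal_mul_I]

namespace WeightedL2Bound

variable {f f' : ℝ → ℂ} {A : ℝ}

theorem norm_integral_Ioi_le (h : WeightedL2Bound f f' A) (hf : Integrable f) (hA : 0 < A)
    {α : ℝ} (hα₁ : 1 / 3 < α) (hα₂ : α < 1 / 2) (t y : ℝ) :
    ‖∫ x in Ioi 0, Complex.exp (Complex.I * ((t * |x| ^ α + y * x : ℝ) : ℂ)) * f x‖ ≤
      288 * (1 - (2⁻¹ : ℝ) ^ (1 / 6 : ℝ))⁻¹ * (A * (1 + |t|) ^ (-(1 : ℝ) / 2)) := by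
  have cψ : Continuous fun x : ℝ => t * |x| ^ α + y * x := by
    have : Continuous fun x : ℝ => |x| ^ α :=
      continuous_abs.rpow_const fun _ => Or.inr (by linarith)
    fun_prop
  have block : ∀ R : ℝ, 0 < R →
      ‖∫ x in R..(2 * R), Complex.exp (Complex.I * ((t * |x| ^ α + y * x : ℝ) : ℂ)) * f x‖ ≤
        144 * (A * (1 + |t|) ^ (-(1 : ℝ) / 2) * (min R R⁻¹) ^ (1 / 6 : ℝ)) := by
    intro R hR
    refine le_of_eq_of_le (congrArg _ (intervalIntegral.integral_congr fun x hx => ?_))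
      (h.norm_dyadic_phase_le hA hα₁ hα₂ hR t y)
    rw [Set.uIcc_of_le (by linarith)] at hx
    simp only [abs_of_pos (hR.trans_le hx.1)]
  have hpow : ∀ k : ℕ, ((2⁻¹ : ℝ) ^ k) ^ (1 / 6 : ℝ) = ((2⁻¹ : ℝ) ^ (1 / 6 : ℝ)) ^ k := fun k =>
    (Real.rpow_pow_comm (by norm_num) _ _).symm
  have hle : ∀ k : ℕ, (2⁻¹ : ℝ) ^ k ≤ 2 ^ k := fun k =>
    pow_le_pow_left₀ (by norm_num) (by norm_num) k
  refine (norm_integral_Ioi_le_of_dyadic (integrable_exp_mul hf _ cψ)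
    (K := 144 * (A * (1 + |t|) ^ (-(1 : ℝ) / 2))) (r := (2⁻¹ : ℝ) ^ (1 / 6 : ℝ)) (by positivity)
    (by positivity) (Real.rpow_lt_one (by norm_num) (by norm_num) (by norm_num)) (fun k => ?_)
    fun k => ?_).trans_eq (by ring)
  · have := block (2 ^ k) (by positivity)
    rwa [← inv_pow, min_eq_right (hle k), hpow, ← mul_assoc] at this
  · have := block (2⁻¹ ^ k) (by positivity)
    rwa [← inv_pow, inv_inv, min_eq_left (hle k), hpow, ← mul_assoc] at this

theorem norm_integral_le (h : WeightedL2Bound f f' A) (hf : Integrable f) (hA : 0 < A)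
    {α : ℝ} (hα₁ : 1 / 3 < α) (hα₂ : α < 1 / 2) (t y : ℝ) :
    ‖∫ x, Complex.exp (Complex.I * ((t * |x| ^ α + y * x : ℝ) : ℂ)) * f x‖ ≤
      576 * (1 - (2⁻¹ : ℝ) ^ (1 / 6 : ℝ))⁻¹ * (A * (1 + |t|) ^ (-(1 : ℝ) / 2)) := by
  have cψ : Continuous fun x : ℝ => t * |x| ^ α + y * x := by
    have : Continuous fun x : ℝ => |x| ^ α :=
      continuous_abs.rpow_const fun _ => Or.inr (by linarith)
    fun_prop
  have hg := integrable_exp_mul hf _ cψ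
  have hneg := integral_comp_neg_Ioi 0
    fun x : ℝ => Complex.exp (Complex.I * ((t * |x| ^ α + y * x : ℝ) : ℂ)) * f x
  rw [neg_zero] at hneg
  have h1 := h.norm_integral_Ioi_le hf hA hα₁ hα₂ t y
  have h2 := h.comp_neg.norm_integral_Ioi_le hf.comp_neg hA hα₁ hα₂ t (-y)
  simp only [abs_neg, mul_neg] at hneg
  simp only [neg_mul] at h2
  rw [hneg] at h2
  rw [← intervalIntegral.integral_Iic_add_Ioi hg.integrableOn hg.integrableOn (b := 0)]
  refine (norm_add_le _ _).trans ?_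
  linarith

end WeightedL2Bound

namespace SchwartzMap

theorem integral_norm_sq_eq (g : SchwartzMap ℝ ℂ) :
    ∫ x, ‖g x‖ ^ 2 = (eLpNorm (⇑g) 2 volume).toReal ^ 2 := by
  rw [(g.memLp 2 volume).eLpNorm_eq_integral_rpow_norm two_ne_zero ENNReal.ofNat_ne_top,
    ENNReal.toReal_ofReal (by positivity), ← Real.rpow_natCast, ← Real.rpow_mul (by positivity)]
  norm_num

theorem integrable_norm_sq (g : SchwartzMap ℝ ℂ) : Integrable fun x => ‖g x‖ ^ 2 :=
  (memLp_two_iff_integrable_sq_norm g.continuous.aestronglyMeasurable).mp (g.memLp 2)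

theorem weightedL2Bound_fourier (φ : SchwartzMap ℝ ℂ) {A : ℝ}
    (hA : (eLpNorm (⇑φ) 2 volume).toReal + (eLpNorm (deriv (⇑φ)) 2 volume).toReal +
      (eLpNorm (fun x : ℝ => (x : ℂ) * deriv (⇑φ) x) 2 volume).toReal ≤ A) :
    WeightedL2Bound (𝓕 (⇑φ)) (deriv (𝓕 (⇑φ))) A := by
  set dφ : SchwartzMap ℝ ℂ := SchwartzMap.derivCLM ℂ ℂ φ with hdφ
  set g : SchwartzMap ℝ ℂ := SchwartzMap.smulLeftCLM ℂ Complex.ofReal dφ with hg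
  have edφ : (⇑dφ) = deriv (⇑φ) := rfl
  have eg : (⇑g) = fun x : ℝ => (x : ℂ) * deriv (⇑φ) x := by
    rw [hg, SchwartzMap.smulLeftCLM_apply (by fun_prop)]
    rfl
  rw [← eg, ← edφ] at hA
  set n₀ := (eLpNorm (⇑φ) 2 volume).toReal with hn₀
  set n₁ := (eLpNorm (⇑dφ) 2 volume).toReal with hn₁
  set n₂ := (eLpNorm (⇑g) 2 volume).toReal with hn₂
  have h₀ : 0 ≤ n₀ := ENNReal.toReal_nonneg
  have h₁ : 0 ≤ n₁ := ENNReal.toReal_nonneg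
  have h₂ : 0 ≤ n₂ := ENNReal.toReal_nonneg
  have hder : ∀ ξ, HasDerivAt (𝓕 (⇑φ)) (deriv (𝓕 (⇑φ)) ξ) ξ := fun ξ =>
    (𝓕 φ : SchwartzMap ℝ ℂ).differentiableAt.hasDerivAt
  have hfd : ∀ ξ : ℝ, 𝓕 (⇑dφ) ξ = 2 * π * I * ξ * 𝓕 (⇑φ) ξ := fun ξ => by
    rw [edφ, Real.fourier_deriv φ.integrable φ.differentiable dφ.integrable]
    rfl
  have hdd : ∀ ξ : ℝ, deriv (𝓕 (⇑dφ)) ξ = -(2 * π * I) * 𝓕 (⇑g) ξ := fun ξ => by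
    have hi : Integrable fun x : ℝ => x • dφ x := by
      have := g.integrable (μ := volume)
      rw [eg] at this
      simpa [edφ] using this
    rw [Real.deriv_fourier dφ.integrable hi]
    have : (fun x : ℝ => (-2 * π * I * x) • dφ x) = (-(2 * π * I)) • (⇑g) := by
      ext x
      simp [eg, edφ]
      ring
    rw [this]
    exact congrFun (VectorFourier.fourierIntegral_const_smul _ _ _ _ _) ξ
  have hmul : ∀ ξ : ℝ, (ξ : ℂ) * deriv (𝓕 (⇑φ)) ξ = -(𝓕 (φ + g) : SchwartzMap ℝ ℂ) ξ := by
    intro ξ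
    have e1 : HasDerivAt (𝓕 (⇑dφ)) (2 * π * I * 1 * 𝓕 (⇑φ) ξ
        + 2 * π * I * ξ * deriv (𝓕 (⇑φ)) ξ) ξ := by
      rw [funext hfd]
      have := (((hasDerivAt_id ξ).ofReal_comp).const_mul (2 * π * I : ℂ)).mul (hder ξ)
      simpa using! this
    have e2 := e1.deriv
    rw [hdd ξ] at e2
    have hne : (2 * π * I : ℂ) ≠ 0 := by
      simp [Real.pi_ne_zero]
    have e3 : (𝓕 (φ + g) : SchwartzMap ℝ ℂ) ξ = 𝓕 (⇑φ) ξ + 𝓕 (⇑g) ξ := by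
      rw [FourierTransform.fourier_add]
      rfl
    rw [e3]
    refine mul_left_cancel₀ hne ?_
    linear_combination -e2
  have nmul : ∀ ξ : ℝ, ξ ^ 2 * ‖deriv (𝓕 (⇑φ)) ξ‖ ^ 2 =
      ‖(𝓕 (φ + g) : SchwartzMap ℝ ℂ) ξ‖ ^ 2 := fun ξ => by
    rw [← norm_neg ((𝓕 (φ + g) : SchwartzMap ℝ ℂ) ξ), ← hmul, norm_mul, mul_pow,
      Complex.norm_real, Real.norm_eq_abs, sq_abs]
  have nd : ∀ ξ : ℝ, ξ ^ 2 * ‖𝓕 (⇑φ) ξ‖ ^ 2 =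
      ((2 * π) ^ 2)⁻¹ * ‖(𝓕 dφ : SchwartzMap ℝ ℂ) ξ‖ ^ 2 := fun ξ => by
    have : ‖(𝓕 dφ : SchwartzMap ℝ ℂ) ξ‖ = 2 * π * |ξ| * ‖𝓕 (⇑φ) ξ‖ := by
      refine (congrArg norm (hfd ξ)).trans ?_
      simp [abs_of_pos Real.pi_pos]
    rw [this, mul_pow (2 * π * |ξ|), mul_pow (2 * π) |ξ|, sq_abs]
    have := Real.pi_ne_zero
    field_simp
  refine ⟨hder, ?_, ?_, ?_, ?_, ?_, ?_, ?_⟩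
  · exact (SchwartzMap.derivCLM ℂ ℂ (𝓕 φ)).continuous
  · exact (𝓕 φ : SchwartzMap ℝ ℂ).integrable_norm_sq
  · refine (SchwartzMap.integral_norm_sq_fourier φ).trans_le ?_
    rw [integral_norm_sq_eq]
    exact pow_le_pow_left₀ h₀ (by linarith) 2
  · simp only [nd]
    exact (𝓕 dφ : SchwartzMap ℝ ℂ).integrable_norm_sq.const_mul _
  · simp only [nd]
    rw [integral_const_mul, SchwartzMap.integral_norm_sq_fourier, integral_norm_sq_eq]
    have hpi : ((2 * π) ^ 2)⁻¹ ≤ 1 := inv_le_one_of_one_le₀ (by nlinarith [Real.pi_gt_three])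
    calc ((2 * π) ^ 2)⁻¹ * n₁ ^ 2 ≤ 1 * n₁ ^ 2 := by gcongr
      _ = n₁ ^ 2 := one_mul _
      _ ≤ _ := pow_le_pow_left₀ h₁ (by linarith) 2
  · simp only [nmul]
    exact (𝓕 (φ + g) : SchwartzMap ℝ ℂ).integrable_norm_sq
  · simp only [nmul]
    rw [SchwartzMap.integral_norm_sq_fourier, integral_norm_sq_eq]
    refine pow_le_pow_left₀ ENNReal.toReal_nonneg ?_ 2
    have hle : eLpNorm (⇑(φ + g)) 2 volume ≤ eLpNorm (⇑φ) 2 volume + eLpNorm (⇑g) 2 volume :=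
      eLpNorm_add_le φ.continuous.aestronglyMeasurable g.continuous.aestronglyMeasurable
        one_le_two
    have htop₁ := (φ.memLp 2 volume).eLpNorm_ne_top
    have htop₂ := (g.memLp 2 volume).eLpNorm_ne_top
    have := ENNReal.toReal_mono (ENNReal.add_ne_top.mpr ⟨htop₁, htop₂⟩) hle
    rw [ENNReal.toReal_add htop₁ htop₂] at this
    linarith

end SchwartzMap

/-- Proposition 3.1: decay for `iu_t − (−Δ)^{α/2}u = 0` with
`1/3 < α < 1/2`: `‖e^{itΦ_α(D)}φ‖_{L^∞} ≤ C(1+|t|)^{−1/2}(‖φ‖_{H¹} + ‖x∂_xφ‖_{L²})`. -/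
theorem fractional_dispersive_decay (α : ℝ) (hα₁ : 1 / 3 < α) (hα₂ : α < 1 / 2) :
    ∃ C > 0, ∀ (φ : SchwartzMap ℝ ℂ) (t : ℝ),
      eLpNorm (𝓕⁻ (fun ξ : ℝ =>
          Complex.exp (Complex.I * t * (|ξ| ^ α : ℝ)) * 𝓕 (⇑φ) ξ)) ⊤ volume ≤
        ENNReal.ofReal (C * (1 + |t|) ^ (-(1 : ℝ) / 2) *
          ((eLpNorm (⇑φ) 2 volume).toReal + (eLpNorm (deriv (⇑φ)) 2 volume).toReal +
            (eLpNorm (fun x : ℝ => (x : ℂ) * deriv (⇑φ) x) 2 volume).toReal)) := by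
  have hr : (2⁻¹ : ℝ) ^ (1 / 6 : ℝ) < 1 :=
    Real.rpow_lt_one (by norm_num) (by norm_num) (by norm_num)
  have hC : 0 < 576 * (1 - (2⁻¹ : ℝ) ^ (1 / 6 : ℝ))⁻¹ :=
    mul_pos (by norm_num) (inv_pos.mpr (by linarith))
  refine ⟨_, hC, fun φ t => ?_⟩
  rw [eLpNorm_exponent_top]
  refine eLpNormEssSup_le_of_ae_bound (Filter.Eventually.of_forall fun x => ?_)
  set n := (eLpNorm (⇑φ) 2 volume).toReal + (eLpNorm (deriv (⇑φ)) 2 volume).toReal +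
    (eLpNorm (fun x : ℝ => (x : ℂ) * deriv (⇑φ) x) 2 volume).toReal with hn
  have hn0 : 0 ≤ n := by positivity
  set D := 576 * (1 - (2⁻¹ : ℝ) ^ (1 / 6 : ℝ))⁻¹ * (1 + |t|) ^ (-(1 : ℝ) / 2) with hD
  have hD0 : 0 < D := by positivity
  have hinv : 𝓕⁻ (fun ξ : ℝ => Complex.exp (Complex.I * t * (|ξ| ^ α : ℝ)) * 𝓕 (⇑φ) ξ) x =
      ∫ ξ, Complex.exp (Complex.I * ((t * |ξ| ^ α + 2 * π * x * ξ : ℝ) : ℂ)) * 𝓕 (⇑φ) ξ := by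
    rw [Real.fourierInv_eq']
    refine integral_congr_ae (Filter.Eventually.of_forall fun ξ => ?_)
    simp only [smul_eq_mul, ← mul_assoc, ← Complex.exp_add, RCLike.inner_apply, conj_trivial]
    congr 2
    push_cast
    ring
  have hbound : ∀ A, n < A →
      ‖𝓕⁻ (fun ξ : ℝ => Complex.exp (Complex.I * t * (|ξ| ^ α : ℝ)) * 𝓕 (⇑φ) ξ) x‖ ≤ D * A := by
    intro A hA
    rw [hinv]
    refine ((φ.weightedL2Bound_fourier hA.le).norm_integral_le
      (𝓕 φ : SchwartzMap ℝ ℂ).integrable (hn0.trans_lt hA) hα₁ hα₂ t _).trans_eq ?_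
    rw [hD]
    ring
  refine le_of_forall_pos_le_add fun ε hε => ?_
  refine (hbound (n + ε / D) (by linarith [div_pos hε hD0])).trans_eq ?_
  field_simp
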